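/- An open cone of label vectors with spurious local minima: suppose there exists a linear subspace V of Y with V ≠ Y such that for every z ∈ V there are ᾱ ∈ D and an open set U ⊆ ℝ^m with ᾱ ∈ U ⊆ D, F(ᾱ) = z, and F(U) ⊆ V. Let V^⊥ denote the orthogonal complement of V in Y and define K := {y₁ + y₂ : y₁ ∈ V, y₂ ∈ V^⊥, ‖y₂‖ > (Θ/(1 − Θ))^{1/2}·‖y₁‖}. Then for every y_d ∈ K the loss L_{y_d} possesses at least one spurious local minimum, i.e., there exist ᾱ ∈ D and an open set U ⊆ ℝ^m with ᾱ ∈ U ⊆ D such that ᾱ is a local but not a global minimizer of L_{y_d} and L_{y_d}(α) − L_{y_d}(ᾱ) ≥ ‖F(α) − F(ᾱ)‖² for all α ∈ U. Moreover, if closure(S) = Y, then K = Y \ V. -/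

import Mathlib

open Filter Metric
open scoped InnerProductSpace

noncomputable section

/-- The optimal value of the squared loss `inf_{α ∈ D} ‖F α - y‖²`. -/
def lossInf {Y : Type} [NormedAddCommGroup Y] {m : ℕ}
    (D : Set (Fin m → ℝ)) (F : (Fin m → ℝ) → Y) (y : Y) : ℝ :=
  sInf ((fun α => ‖F α - y‖ ^ 2) '' D)

/-- The worst-case error bound `Θ = sup_{‖y‖ = 1} inf_{α ∈ D} ‖F α - y‖²`. -/
def Theta {Y : Type} [NormedAddCommGroup Y] {m : ℕ}
    (D : Set (Fin m → ℝ)) (F : (Fin m → ℝ) → Y) : ℝ :=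
  sSup ((fun y => lossInf D F y) '' {y : Y | ‖y‖ = 1})

/-- The set of best approximations of `y` in `closure (F '' D)`. -/
def bestApprox {Y : Type} [NormedAddCommGroup Y] {m : ℕ}
    (D : Set (Fin m → ℝ)) (F : (Fin m → ℝ) → Y) (y : Y) : Set Y :=
  {z | z ∈ closure (F '' D) ∧ ‖z - y‖ = Metric.infDist y (closure (F '' D))}

theorem bddBelow_loss {Y : Type} [NormedAddCommGroup Y] {m : ℕ}
    (D : Set (Fin m → ℝ)) (F : (Fin m → ℝ) → Y) (y : Y) :
    BddBelow ((fun α => ‖F α - y‖ ^ 2) '' D) :=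
  ⟨0, by rintro _ ⟨α, -, rfl⟩; positivity⟩

theorem lossInf_eq_infDist_sq {Y : Type} [NormedAddCommGroup Y] {m : ℕ}
    {D : Set (Fin m → ℝ)} (hD : D.Nonempty) (F : (Fin m → ℝ) → Y) (y : Y) :
    lossInf D F y = Metric.infDist y (F '' D) ^ 2 := by
  have hnonneg : 0 ≤ lossInf D F y :=
    Real.sInf_nonneg (by rintro _ ⟨α, -, rfl⟩; positivity)
  apply le_antisymm
  · rw [← Real.sqrt_le_left Metric.infDist_nonneg]
    rw [Metric.le_infDist (hD.image F)]
    rintro _ ⟨α, hα, rfl⟩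
    rw [dist_comm, dist_eq_norm]
    exact Real.sqrt_le_iff.2 ⟨norm_nonneg _,
      csInf_le (bddBelow_loss D F y) ⟨α, hα, rfl⟩⟩
  · refine le_csInf (hD.image _) ?_
    rintro _ ⟨α, hα, rfl⟩
    have h := Metric.infDist_le_dist_of_mem (x := y) (Set.mem_image_of_mem F hα)
    rw [dist_comm, dist_eq_norm] at h
    exact pow_le_pow_left₀ Metric.infDist_nonneg h 2

theorem continuous_lossInf {Y : Type} [NormedAddCommGroup Y] {m : ℕ}
    {D : Set (Fin m → ℝ)} (hD : D.Nonempty) (F : (Fin m → ℝ) → Y) :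
    Continuous (lossInf D F) := by
  rw [funext (lossInf_eq_infDist_sq hD F)]
  exact (Metric.continuous_infDist_pt _).pow 2

theorem isCompact_unit_norm (Y : Type) [NormedAddCommGroup Y] [InnerProductSpace ℝ Y]
    [FiniteDimensional ℝ Y] : IsCompact {y : Y | ‖y‖ = 1} := by
  have : ProperSpace Y := FiniteDimensional.proper ℝ Y
  have h : {y : Y | ‖y‖ = 1} = Metric.sphere 0 1 := by ext; simp
  exact h ▸ isCompact_sphere 0 1

theorem Theta_lt_one {Y : Type} [NormedAddCommGroup Y] [InnerProductSpace ℝ Y]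
    [FiniteDimensional ℝ Y] [Nontrivial Y] {m : ℕ}
    {D : Set (Fin m → ℝ)} (hD : D.Nonempty) (F : (Fin m → ℝ) → Y)
    (hexpr : ∀ y : Y, y ≠ 0 → lossInf D F y < ‖y‖ ^ 2) : Theta D F < 1 := by
  obtain ⟨u, hu, hmax⟩ := (isCompact_unit_norm Y).exists_sSup_image_eq
    (exists_norm_eq Y zero_le_one) (continuous_lossInf hD F).continuousOn
  have hu1 : ‖u‖ = 1 := hu
  have h := hexpr u (norm_ne_zero_iff.1 (by simp [hu1]))
  rw [hu1, one_pow] at h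
  exact hmax.trans_lt h

theorem Theta_nonneg {Y : Type} [NormedAddCommGroup Y] {m : ℕ}
    (D : Set (Fin m → ℝ)) (F : (Fin m → ℝ) → Y) : 0 ≤ Theta D F := by
  refine Real.sSup_nonneg ?_
  rintro _ ⟨y, -, rfl⟩
  exact Real.sInf_nonneg (by rintro _ ⟨α, -, rfl⟩; positivity)

/-- Conicity of the image turns the bound on the unit sphere into a homogeneous bound. -/
theorem lossInf_le_Theta_mul {Y : Type} [NormedAddCommGroup Y] [InnerProductSpace ℝ Y]
    [FiniteDimensional ℝ Y] {m : ℕ}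
    {D : Set (Fin m → ℝ)} (hD : D.Nonempty) (F : (Fin m → ℝ) → Y)
    (hcone : ∀ y ∈ F '' D, ∀ s : ℝ, 0 < s → s • y ∈ F '' D) {y : Y} (hy : y ≠ 0) :
    lossInf D F y ≤ Theta D F * ‖y‖ ^ 2 := by
  have hr : 0 < ‖y‖ := norm_pos_iff.2 hy
  have hbdd := (isCompact_unit_norm Y).bddAbove_image (continuous_lossInf hD F).continuousOn
  have hu : ‖‖y‖⁻¹ • y‖ = 1 := by
    rw [norm_smul, norm_inv, norm_norm, inv_mul_cancel₀ hr.ne']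
  have hle : lossInf D F (‖y‖⁻¹ • y) ≤ Theta D F := le_csSup hbdd ⟨_, hu, rfl⟩
  refine le_trans ?_ (mul_le_mul_of_nonneg_right hle (by positivity))
  rw [← div_le_iff₀ (by positivity)]
  refine le_csInf (hD.image _) ?_
  rintro _ ⟨α, hα, rfl⟩
  obtain ⟨β, hβ, hFβ⟩ := hcone _ (Set.mem_image_of_mem F hα) _ hr
  rw [div_le_iff₀ (by positivity)]
  have h : lossInf D F y ≤ ‖F β - y‖ ^ 2 := csInf_le (bddBelow_loss D F y) ⟨β, hβ, rfl⟩
  have hscale : F β - y = ‖y‖ • (F α - ‖y‖⁻¹ • y) := by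
    rw [hFβ, smul_sub, smul_inv_smul₀ hr.ne']
  rw [hscale, norm_smul, norm_norm, mul_pow] at h
  linarith

theorem norm_sub_add_sq_of_mem_orthogonal {Y : Type} [NormedAddCommGroup Y]
    [InnerProductSpace ℝ Y] {V : Submodule ℝ Y} {v y₁ y₂ : Y} (hv : v ∈ V) (h₁ : y₁ ∈ V)
    (h₂ : y₂ ∈ Vᗮ) : ‖v - (y₁ + y₂)‖ ^ 2 = ‖v - y₁‖ ^ 2 + ‖y₂‖ ^ 2 := by
  have h := Submodule.inner_right_of_mem_orthogonal (V.sub_mem hv h₁) h₂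
  rw [← sub_sub, norm_sub_sq_real, h]
  ring

theorem Theta_eq_zero_of_dense {Y : Type} [NormedAddCommGroup Y] {m : ℕ}
    {D : Set (Fin m → ℝ)} (hD : D.Nonempty) (F : (Fin m → ℝ) → Y)
    (hdense : closure (F '' D) = Set.univ) : Theta D F = 0 := by
  refine le_antisymm (Real.sSup_nonpos ?_) (Theta_nonneg D F)
  rintro _ ⟨y, -, rfl⟩
  have h : Metric.infDist y (F '' D) = 0 :=
    (Metric.mem_closure_iff_infDist_zero (hD.image F)).1 (hdense ▸ Set.mem_univ y)
  simp [lossInf_eq_infDist_sq hD, h]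

theorem open_cone_of_spurious_minima {Y : Type} [NormedAddCommGroup Y]
    [InnerProductSpace ℝ Y] [FiniteDimensional ℝ Y] [Nontrivial Y] {m : ℕ}
    (D : Set (Fin m → ℝ)) (hD : D.Nonempty) (F : (Fin m → ℝ) → Y)
    (hcone : ∀ y ∈ F '' D, ∀ s : ℝ, 0 < s → s • y ∈ F '' D)
    (hexpr : ∀ y : Y, y ≠ 0 → lossInf D F y < ‖y‖ ^ 2)
    (V : Submodule ℝ Y) (hV : V ≠ ⊤)
    (hparam : ∀ z ∈ V, ∃ abar : Fin m → ℝ, ∃ U : Set (Fin m → ℝ),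
      IsOpen U ∧ abar ∈ U ∧ U ⊆ D ∧ F abar = z ∧ F '' U ⊆ V) :
    (∀ yd ∈ {y : Y | ∃ y₁ ∈ V, ∃ y₂ ∈ Vᗮ, y = y₁ + y₂ ∧
        Real.sqrt (Theta D F / (1 - Theta D F)) * ‖y₁‖ < ‖y₂‖},
      ∃ abar ∈ D, ∃ U : Set (Fin m → ℝ), IsOpen U ∧ abar ∈ U ∧ U ⊆ D ∧
        IsLocalMinOn (fun α => ‖F α - yd‖ ^ 2) D abar ∧
        ¬ IsMinOn (fun α => ‖F α - yd‖ ^ 2) D abar ∧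
        ∀ α ∈ U, ‖F α - F abar‖ ^ 2 ≤ ‖F α - yd‖ ^ 2 - ‖F abar - yd‖ ^ 2) ∧
    (closure (F '' D) = Set.univ →
      {y : Y | ∃ y₁ ∈ V, ∃ y₂ ∈ Vᗮ, y = y₁ + y₂ ∧
        Real.sqrt (Theta D F / (1 - Theta D F)) * ‖y₁‖ < ‖y₂‖} =
      {y : Y | y ∉ V}) := by
  refine ⟨?_, fun hdense => ?_⟩
  · rintro _ ⟨y₁, h₁, y₂, h₂, rfl, hlt⟩
    obtain ⟨abar, U, hUo, haU, hUD, hFa, hFU⟩ := hparam y₁ h₁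
    have hloss : ‖F abar - (y₁ + y₂)‖ ^ 2 = ‖y₂‖ ^ 2 := by
      rw [hFa, sub_add_cancel_left, norm_neg]
    have hgrowth : ∀ α ∈ U, ‖F α - F abar‖ ^ 2 ≤
        ‖F α - (y₁ + y₂)‖ ^ 2 - ‖F abar - (y₁ + y₂)‖ ^ 2 := by
      intro α hα
      rw [hloss, hFa,
        norm_sub_add_sq_of_mem_orthogonal (hFU (Set.mem_image_of_mem F hα)) h₁ h₂]
      simp
    refine ⟨abar, hUD haU, U, hUo, haU, hUD, ?_, fun hmin => ?_, hgrowth⟩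
    · filter_upwards [mem_nhdsWithin_of_mem_nhds (hUo.mem_nhds haU)] with α hα
      have := hgrowth α hα
      have := sq_nonneg ‖F α - F abar‖
      linarith
    · have hy₂ : 0 < ‖y₂‖ := lt_of_le_of_lt (by positivity) hlt
      have hΘ := Theta_lt_one hD F hexpr
      have hnorm : ‖y₁ + y₂‖ ^ 2 = ‖y₁‖ ^ 2 + ‖y₂‖ ^ 2 := by
        simpa only [zero_sub, norm_neg] using
          norm_sub_add_sq_of_mem_orthogonal V.zero_mem h₁ h₂
      have hne : y₁ + y₂ ≠ 0 := by
        intro h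
        rw [h, norm_zero] at hnorm
        nlinarith [sq_nonneg ‖y₁‖]
      have hinf : ‖y₂‖ ^ 2 ≤ lossInf D F (y₁ + y₂) := by
        refine le_csInf (hD.image _) ?_
        rintro _ ⟨α, hα, rfl⟩
        exact hloss ▸ hmin hα
      have hub := hinf.trans (lossInf_le_Theta_mul hD F hcone hne)
      rw [hnorm] at hub
      have hsq := pow_lt_pow_left₀ hlt (by positivity) two_ne_zero
      rw [mul_pow, Real.sq_sqrt (div_nonneg (Theta_nonneg D F) (by linarith)),
        div_mul_eq_mul_div, div_lt_iff₀ (by linarith)] at hsq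
      linarith
  · ext y
    simp only [Theta_eq_zero_of_dense hD F hdense, zero_div, Real.sqrt_zero, zero_mul,
      norm_pos_iff, Set.mem_ofPred_eq]
    constructor
    · rintro ⟨y₁, h₁, y₂, h₂, rfl, hne⟩ hy
      have hy₂ : y₂ ∈ V := (V.add_mem_iff_right h₁).1 hy
      exact hne (inner_self_eq_zero.1 (Submodule.inner_right_of_mem_orthogonal hy₂ h₂))
    · intro hy
      obtain ⟨y₁, h₁, y₂, h₂, rfl⟩ := V.exists_add_mem_mem_orthogonal y
      refine ⟨y₁, h₁, y₂, h₂, rfl, ?_⟩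
      rintro rfl
      exact hy (by simpa using h₁)
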